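/- arXiv:2605.12000 — 2 statements merged into one kernel-verified Lean document; each statement's English description precedes it below -/
import Mathlib

section
/- Let M be a MOMDP with finite state space X and finite action space A, and let π_A and π_B be neighboring Pareto front policies (deterministic) that differ in exactly k states. Then there exists a finite sequence of k+1 deterministic Pareto front policies (π_0, π_1, ..., π_k) with π_0 = π_A and π_k = π_B such that consecutive policies in the sequence differ in exactly one state, i.e. the number of states x with π_{i-1}(x) ≠ π_i(x) equals 1 for every i ∈ {1, ..., k}. -/
open scoped BigOperators
open Classical

/-- A Multi-Objective Markov Decision Process with finite state space `X`,
finite action space `A`, and `d`-dimensional rewards in `[0,1]^d`. -/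
structure MOMDP (X A : Type) [Fintype X] [Fintype A] (d : ℕ) where
  P : X → A → X → ℝ
  P_nonneg : ∀ x a x', 0 ≤ P x a x'
  P_sum_one : ∀ x a, ∑ x', P x a x' = 1
  disc : ℝ
  disc_nonneg : 0 ≤ disc
  disc_lt_one : disc < 1
  init : X → ℝ
  init_nonneg : ∀ x, 0 ≤ init x
  init_sum_one : ∑ x, init x = 1
  r : X → A → Fin d → ℝ
  r_nonneg : ∀ x a i, 0 ≤ r x a i
  r_le_one : ∀ x a i, r x a i ≤ 1

/-- A stationary (Markov) policy: a map from states to distributions over actions. -/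
def IsPolicy {X A : Type} [Fintype A] (π : X → A → ℝ) : Prop :=
  (∀ x a, 0 ≤ π x a) ∧ ∀ x, ∑ a, π x a = 1

/-- The stochastic policy induced by a deterministic policy `f : X → A`. -/
noncomputable def detPolicy {X A : Type} (f : X → A) : X → A → ℝ :=
  fun x a => if a = f x then 1 else 0

/-- The distribution of the state at time `t` under policy `π`. -/
noncomputable def stateDist {X A : Type} [Fintype X] [Fintype A] {d : ℕ}
    (M : MOMDP X A d) (π : X → A → ℝ) : ℕ → X → ℝ
  | 0 => M.init
  | t + 1 => fun x' => ∑ x, ∑ a, stateDist M π t x * π x a * M.P x a x'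

/-- The expected discounted vector return `J(π)`, componentwise. -/
noncomputable def Jret {X A : Type} [Fintype X] [Fintype A] {d : ℕ}
    (M : MOMDP X A d) (π : X → A → ℝ) (i : Fin d) : ℝ :=
  ∑' t : ℕ, M.disc ^ t * ∑ x, ∑ a, stateDist M π t x * π x a * M.r x a i

/-- Pareto front policy: no stationary policy weakly dominates it in all objectives and
strictly in one. -/
def IsPF {X A : Type} [Fintype X] [Fintype A] {d : ℕ}
    (M : MOMDP X A d) (π : X → A → ℝ) : Prop :=
  ¬ ∃ π' : X → A → ℝ, IsPolicy π' ∧ (∀ i, Jret M π i ≤ Jret M π' i) ∧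
      ∃ j, Jret M π j < Jret M π' j

/-- The discounted state occupancy measure `ν^π`. -/
noncomputable def stateOcc {X A : Type} [Fintype X] [Fintype A] {d : ℕ}
    (M : MOMDP X A d) (π : X → A → ℝ) (x : X) : ℝ :=
  (1 - M.disc) * ∑' t : ℕ, M.disc ^ t * stateDist M π t x

/-- The discounted state-action occupancy measure `μ^π`. -/
noncomputable def occ {X A : Type} [Fintype X] [Fintype A] {d : ℕ}
    (M : MOMDP X A d) (π : X → A → ℝ) (p : X × A) : ℝ :=
  stateOcc M π p.1 * π p.1 p.2

/-- `ε`-approximate Pareto front property for a (randomized) output with expected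
return vector `EJ`. -/
def IsEpsPF {X A : Type} [Fintype X] [Fintype A] {d : ℕ}
    (M : MOMDP X A d) (EJ : Fin d → ℝ) (ε : ℝ) : Prop :=
  ¬ ∃ π : X → A → ℝ, IsPolicy π ∧ (∀ i, ε ≤ Jret M π i - EJ i) ∧
      ∃ j, ε < Jret M π j - EJ j

section Helpers

variable {X A : Type} [Fintype X] [Fintype A] {d : ℕ}

/-- Expected one-step payoff at time `t`. -/
noncomputable def stepE (M : MOMDP X A d) (π : X → A → ℝ) (g : X → A → ℝ) (t : ℕ) : ℝ :=
  M.disc ^ t * ∑ x, ∑ a, stateDist M π t x * π x a * g x a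

/-- Expected discounted payoff. -/
noncomputable def totE (M : MOMDP X A d) (π : X → A → ℝ) (g : X → A → ℝ) : ℝ :=
  ∑' t : ℕ, stepE M π g t

lemma stateDist_nonneg (M : MOMDP X A d) {π : X → A → ℝ} (hπ : IsPolicy π) (t : ℕ) :
    ∀ x, 0 ≤ stateDist M π t x := by
  induction t with
  | zero => exact M.init_nonneg
  | succ t ih =>
    intro x
    simp only [stateDist]
    exact Finset.sum_nonneg fun y _ => Finset.sum_nonneg fun a _ =>
      mul_nonneg (mul_nonneg (ih y) (hπ.1 y a)) (M.P_nonneg y a x)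

lemma sum_sum_policy (π : X → A → ℝ) (hπ : IsPolicy π) (h : X → ℝ) (V : X → ℝ) :
    ∑ x, ∑ a, h x * π x a * V x = ∑ x, h x * V x := by
  refine Finset.sum_congr rfl fun x _ => ?_
  have : ∑ a, h x * π x a * V x = (h x * V x) * ∑ a, π x a := by
    rw [Finset.mul_sum]
    exact Finset.sum_congr rfl fun a _ => by ring
  rw [this, hπ.2 x, mul_one]

lemma sum_stateDist_succ (M : MOMDP X A d) (π : X → A → ℝ) (t : ℕ) (V : X → ℝ) :
    ∑ y, stateDist M π (t + 1) y * V y =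
      ∑ x, ∑ a, stateDist M π t x * π x a * ∑ y, M.P x a y * V y := by
  simp only [stateDist, Finset.sum_mul, Finset.mul_sum]
  rw [Finset.sum_comm]
  refine Finset.sum_congr rfl fun x _ => ?_
  rw [Finset.sum_comm]
  refine Finset.sum_congr rfl fun a _ => ?_
  exact Finset.sum_congr rfl fun y _ => by ring

lemma stateDist_sum (M : MOMDP X A d) {π : X → A → ℝ} (hπ : IsPolicy π) (t : ℕ) :
    ∑ x, stateDist M π t x = 1 := by
  induction t with
  | zero => exact M.init_sum_one
  | succ t ih =>
    have h := sum_stateDist_succ M π t (fun _ => 1)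
    simp only [mul_one, M.P_sum_one] at h
    rw [h]
    have h2 := sum_sum_policy π hπ (stateDist M π t) (fun _ => 1)
    simp only [mul_one] at h2
    rw [h2, ih]

lemma summable_stepE (M : MOMDP X A d) {π : X → A → ℝ} (hπ : IsPolicy π) (g : X → A → ℝ) :
    Summable (stepE M π g) := by
  set C : ℝ := ∑ x, ∑ a, |g x a| with hC
  have hg : ∀ x a, |g x a| ≤ C := by
    intro x a
    calc |g x a| ≤ ∑ a, |g x a| :=
          Finset.single_le_sum (f := fun a => |g x a|) (fun _ _ => abs_nonneg _)
            (Finset.mem_univ a)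
      _ ≤ C := Finset.single_le_sum (f := fun x => ∑ a, |g x a|)
            (fun _ _ => Finset.sum_nonneg fun _ _ => abs_nonneg _) (Finset.mem_univ x)
  refine Summable.of_norm_bounded
    ((summable_geometric_of_lt_one M.disc_nonneg M.disc_lt_one).mul_right C) ?_
  intro t
  rw [Real.norm_eq_abs, stepE, abs_mul, abs_of_nonneg (pow_nonneg M.disc_nonneg t)]
  refine mul_le_mul_of_nonneg_left ?_ (pow_nonneg M.disc_nonneg t)
  calc |∑ x, ∑ a, stateDist M π t x * π x a * g x a|
      ≤ ∑ x, |∑ a, stateDist M π t x * π x a * g x a| := Finset.abs_sum_le_sum_abs _ _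
    _ ≤ ∑ x, ∑ a, |stateDist M π t x * π x a * g x a| :=
        Finset.sum_le_sum fun x _ => Finset.abs_sum_le_sum_abs _ _
    _ ≤ ∑ x, ∑ a, stateDist M π t x * π x a * C := by
        refine Finset.sum_le_sum fun x _ => Finset.sum_le_sum fun a _ => ?_
        have h0 := mul_nonneg (stateDist_nonneg M hπ t x) (hπ.1 x a)
        rw [abs_mul, abs_of_nonneg h0]
        exact mul_le_mul_of_nonneg_left (hg x a) h0
    _ = C := by
        rw [sum_sum_policy π hπ (stateDist M π t) (fun _ => C), ← Finset.sum_mul,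
          stateDist_sum M hπ t, one_mul]

lemma totE_add (M : MOMDP X A d) {π : X → A → ℝ} (hπ : IsPolicy π) (g h : X → A → ℝ) :
    totE M π (fun x a => g x a + h x a) = totE M π g + totE M π h := by
  unfold totE
  rw [← (summable_stepE M hπ g).tsum_add (summable_stepE M hπ h)]
  refine tsum_congr fun t => ?_
  simp only [stepE, mul_add, Finset.sum_add_distrib]

lemma totE_smul (M : MOMDP X A d) (π : X → A → ℝ) (c : ℝ) (g : X → A → ℝ) :
    totE M π (fun x a => c * g x a) = c * totE M π g := by
  unfold totE
  rw [← tsum_mul_left]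
  refine tsum_congr fun t => ?_
  simp only [stepE, Finset.mul_sum]
  refine Finset.sum_congr rfl fun x _ => Finset.sum_congr rfl fun a _ => by ring

lemma totE_sum (M : MOMDP X A d) {π : X → A → ℝ} (hπ : IsPolicy π) {ι : Type} (s : Finset ι)
    (g : ι → X → A → ℝ) :
    totE M π (fun x a => ∑ i ∈ s, g i x a) = ∑ i ∈ s, totE M π (g i) := by
  induction s using Finset.induction_on with
  | empty => simp [totE, stepE]
  | insert i s hi ih =>
    simp only [Finset.sum_insert hi]
    rw [totE_add M hπ, ih]

lemma wJ_eq (M : MOMDP X A d) {π : X → A → ℝ} (hπ : IsPolicy π) (w : Fin d → ℝ) :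
    ∑ i, w i * Jret M π i = totE M π (fun x a => ∑ i, w i * M.r x a i) := by
  rw [totE_sum M hπ]
  refine Finset.sum_congr rfl fun i _ => ?_
  rw [totE_smul]
  rfl

lemma totE_value (M : MOMDP X A d) {π : X → A → ℝ} (hπ : IsPolicy π) (V : X → ℝ) :
    totE M π (fun x _ => V x) =
      ∑ x, M.init x * V x + M.disc * totE M π (fun x a => ∑ y, M.P x a y * V y) := by
  unfold totE
  rw [(summable_stepE M hπ (fun x _ => V x)).tsum_eq_zero_add, ← tsum_mul_left]
  congr 1
  · simp only [stepE, pow_zero, one_mul]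
    rw [sum_sum_policy π hπ]
    rfl
  · refine tsum_congr fun t => ?_
    simp only [stepE]
    rw [sum_sum_policy π hπ, sum_stateDist_succ]
    ring

lemma wJ_gap (M : MOMDP X A d) {π : X → A → ℝ} (hπ : IsPolicy π) (w : Fin d → ℝ)
    (V : X → ℝ) :
    ∑ i, w i * Jret M π i + totE M π (fun x a => V x -
      (∑ i, w i * M.r x a i + M.disc * ∑ y, M.P x a y * V y)) = ∑ x, M.init x * V x := by
  have h1 := totE_value M hπ V
  have h2 : totE M π (fun x _ => V x) =
      totE M π (fun x a => ∑ i, w i * M.r x a i) + (totE M π (fun x a => V x -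
      (∑ i, w i * M.r x a i + M.disc * ∑ y, M.P x a y * V y)) +
       M.disc * totE M π (fun x a => ∑ y, M.P x a y * V y)) := by
    rw [← totE_smul, ← totE_add M hπ, ← totE_add M hπ]
    congr 1
    funext x a
    ring
  rw [wJ_eq M hπ]
  linarith

lemma stepE_nonneg (M : MOMDP X A d) {π : X → A → ℝ} (hπ : IsPolicy π) {g : X → A → ℝ}
    (hg : ∀ x a, 0 ≤ g x a) (t : ℕ) : 0 ≤ stepE M π g t :=
  mul_nonneg (pow_nonneg M.disc_nonneg t) <| Finset.sum_nonneg fun x _ =>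
    Finset.sum_nonneg fun a _ =>
      mul_nonneg (mul_nonneg (stateDist_nonneg M hπ t x) (hπ.1 x a)) (hg x a)

/-- Existence of the optimal value function. -/
lemma exists_value (M : MOMDP X A d) [Nonempty A] (ρ : X → A → ℝ) :
    ∃ V : X → ℝ, ∃ f : X → A,
      (∀ x a, ρ x a + M.disc * ∑ y, M.P x a y * V y ≤ V x) ∧
      ∀ x, ρ x (f x) + M.disc * ∑ y, M.P x (f x) y * V y = V x := by
  have hne : (Finset.univ : Finset A).Nonempty := Finset.univ_nonempty
  let Q : (X → ℝ) → X → A → ℝ := fun V x a => ρ x a + M.disc * ∑ y, M.P x a y * V y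
  let T : (X → ℝ) → X → ℝ := fun V x => Finset.univ.sup' hne (Q V x)
  have hQ : ∀ U V x a, Q U x a ≤ Q V x a + M.disc * dist U V := by
    intro U V x a
    have : ∑ y, M.P x a y * U y ≤ ∑ y, M.P x a y * V y + dist U V := by
      calc ∑ y, M.P x a y * U y ≤ ∑ y, (M.P x a y * V y + M.P x a y * dist U V) := by
            refine Finset.sum_le_sum fun y _ => ?_
            rw [← mul_add]
            refine mul_le_mul_of_nonneg_left ?_ (M.P_nonneg x a y)
            have h := dist_le_pi_dist U V y
            rw [Real.dist_eq] at h
            have := le_abs_self (U y - V y)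
            linarith
        _ = _ := by rw [Finset.sum_add_distrib, ← Finset.sum_mul, M.P_sum_one, one_mul]
    have := mul_le_mul_of_nonneg_left this M.disc_nonneg
    simp only [Q]
    linarith
  have hT : ∀ U V x, T U x ≤ T V x + M.disc * dist U V := by
    intro U V x
    refine Finset.sup'_le _ _ fun a _ => (hQ U V x a).trans ?_
    have := Finset.le_sup' (Q V x) (Finset.mem_univ a)
    simp only [T]
    linarith
  have hc : ContractingWith ⟨M.disc, M.disc_nonneg⟩ T := by
    refine ⟨?_, LipschitzWith.of_dist_le_mul fun U V => ?_⟩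
    · exact_mod_cast M.disc_lt_one
    · have h0 : 0 ≤ M.disc * dist U V := mul_nonneg M.disc_nonneg dist_nonneg
      refine (dist_pi_le_iff h0).2 fun x => ?_
      rw [Real.dist_eq, abs_le]
      have h1 := hT U V x
      have h2 := hT V U x
      rw [dist_comm] at h2
      constructor <;> linarith
  have hfix : T (hc.fixedPoint T) = hc.fixedPoint T := hc.fixedPoint_isFixedPt
  set V := hc.fixedPoint T
  have hex : ∀ x, ∃ a, Q V x a = V x := by
    intro x
    obtain ⟨a, _, ha⟩ := Finset.exists_mem_eq_sup' hne (Q V x)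
    exact ⟨a, by rw [← ha]; exact congrFun hfix x⟩
  choose f hf using hex
  refine ⟨V, f, fun x a => ?_, hf⟩
  have := Finset.le_sup' (Q V x) (Finset.mem_univ a)
  exact this.trans (congrFun hfix x).le

lemma isPolicy_det (f : X → A) : IsPolicy (detPolicy f) := by
  refine ⟨fun x a => ?_, fun x => ?_⟩
  · unfold detPolicy
    split_ifs <;> norm_num
  · simp [detPolicy]

lemma sum_det (f : X → A) (x : X) (c : ℝ) (g : A → ℝ) :
    ∑ a, c * detPolicy f x a * g a = c * g (f x) := by
  simp [detPolicy]

lemma stepE_det (M : MOMDP X A d) (f : X → A) (g : X → A → ℝ) (t : ℕ) :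
    stepE M (detPolicy f) g t =
      M.disc ^ t * ∑ x, stateDist M (detPolicy f) t x * g x (f x) := by
  simp only [stepE, sum_det]

lemma stateDist_det_succ (M : MOMDP X A d) (f : X → A) (t : ℕ) (y : X) :
    stateDist M (detPolicy f) (t + 1) y =
      ∑ x, stateDist M (detPolicy f) t x * M.P x (f x) y := by
  simp only [stateDist, sum_det]

/-- States visited with positive discounted probability. -/
def reach (M : MOMDP X A d) (f : X → A) : Set X :=
  {x | ∃ t, M.disc ^ t * stateDist M (detPolicy f) t x ≠ 0}

lemma init_reach (M : MOMDP X A d) (f : X → A) {x : X} (h : M.init x ≠ 0) :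
    x ∈ reach M f := ⟨0, by simpa [stateDist] using h⟩

lemma step_reach (M : MOMDP X A d) (f : X → A) {x y : X} (hx : x ∈ reach M f)
    (h : M.disc * M.P x (f x) y ≠ 0) : y ∈ reach M f := by
  obtain ⟨t, ht⟩ := hx
  refine ⟨t + 1, ?_⟩
  have hd : M.disc ≠ 0 := left_ne_zero_of_mul h
  have hP : M.P x (f x) y ≠ 0 := right_ne_zero_of_mul h
  have hs : stateDist M (detPolicy f) t x ≠ 0 := right_ne_zero_of_mul ht
  refine mul_ne_zero (pow_ne_zero _ hd) ?_
  rw [stateDist_det_succ]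
  have hnn : ∀ z ∈ Finset.univ, 0 ≤ stateDist M (detPolicy f) t z * M.P z (f z) y :=
    fun z _ => mul_nonneg (stateDist_nonneg M (isPolicy_det f) t z) (M.P_nonneg _ _ _)
  intro h0
  have := (Finset.sum_eq_zero_iff_of_nonneg hnn).1 h0 x (Finset.mem_univ x)
  exact mul_ne_zero hs hP this

lemma gap_zero_of_reach (M : MOMDP X A d) (f : X → A) {g : X → A → ℝ}
    (hg : ∀ x a, 0 ≤ g x a) (h0 : totE M (detPolicy f) g = 0) {x : X} (hx : x ∈ reach M f) :
    g x (f x) = 0 := by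
  obtain ⟨t, ht⟩ := hx
  have hp := isPolicy_det f
  have hs := (summable_stepE M hp g).hasSum
  have h1 : stepE M (detPolicy f) g = 0 := by
    rw [show (∑' t, stepE M (detPolicy f) g t) = 0 from h0] at hs
    exact (hasSum_zero_iff_of_nonneg (stepE_nonneg M hp hg)).1 hs
  have h2 := congrFun h1 t
  rw [stepE_det, Finset.mul_sum] at h2
  have hnn : ∀ z ∈ Finset.univ,
      0 ≤ M.disc ^ t * (stateDist M (detPolicy f) t z * g z (f z)) :=
    fun z _ => mul_nonneg (pow_nonneg M.disc_nonneg t)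
      (mul_nonneg (stateDist_nonneg M hp t z) (hg _ _))
  have h3 := (Finset.sum_eq_zero_iff_of_nonneg hnn).1 h2 x (Finset.mem_univ x)
  rw [← mul_assoc] at h3
  exact (mul_eq_zero.1 h3).resolve_left ht

lemma gap_zero_of_closed (M : MOMDP X A d) (f : X → A) {g : X → A → ℝ} (S : Set X)
    (hi : ∀ x, M.init x ≠ 0 → x ∈ S)
    (hc : ∀ x y, x ∈ S → M.disc * M.P x (f x) y ≠ 0 → y ∈ S)
    (hS : ∀ x ∈ S, g x (f x) = 0) : totE M (detPolicy f) g = 0 := by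
  have key : ∀ t x, M.disc ^ t * stateDist M (detPolicy f) t x ≠ 0 → x ∈ S := by
    intro t
    induction t with
    | zero =>
      intro x hx
      exact hi x (by simpa [stateDist] using hx)
    | succ t ih =>
      intro y hy
      rw [stateDist_det_succ, Finset.mul_sum] at hy
      obtain ⟨x, _, hx⟩ := Finset.exists_ne_zero_of_sum_ne_zero hy
      have e : M.disc ^ (t + 1) * (stateDist M (detPolicy f) t x * M.P x (f x) y) =
        (M.disc ^ t * stateDist M (detPolicy f) t x) * (M.disc * M.P x (f x) y) := by ring
      rw [e] at hx
      exact hc x y (ih x (left_ne_zero_of_mul hx)) (right_ne_zero_of_mul hx)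
  have : ∀ t, stepE M (detPolicy f) g t = 0 := by
    intro t
    rw [stepE_det, Finset.mul_sum]
    refine Finset.sum_eq_zero fun x _ => ?_
    rw [← mul_assoc]
    by_cases h : M.disc ^ t * stateDist M (detPolicy f) t x = 0
    · rw [h, zero_mul]
    · rw [hS x (key t x h), mul_zero]
  simp [totE, this]

/-- An enumeration of a finite set compatible with a key function. -/
lemma exists_rank (D : Finset X) (k : ℕ) (hk : D.card = k) (c : X → ℕ) :
    ∃ ρ : X → ℕ, (∀ x ∈ D, ∀ y ∈ D, c x < c y → ρ x < ρ y) ∧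
      (∀ x ∈ D, ρ x < k) ∧ ∀ i < k, ∃ x ∈ D, ρ x = i ∧ ∀ y ∈ D, ρ y = i → y = x := by
  let e : D ≃ Fin k := D.equivFinOfCardEq hk
  let κ : Fin k → ℕ := fun i => c (e.symm i)
  let σ := Tuple.sort κ
  have hm : Monotone (κ ∘ σ) := Tuple.monotone_sort κ
  let ρ : X → ℕ := fun x => if h : x ∈ D then (σ.symm (e ⟨x, h⟩) : ℕ) else 0
  have hρ : ∀ x (h : x ∈ D), ρ x = σ.symm (e ⟨x, h⟩) := fun x h => by simp [ρ, h]
  have hκ : ∀ x (h : x ∈ D), (κ ∘ σ) (σ.symm (e ⟨x, h⟩)) = c x := fun x h => by simp [κ]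
  refine ⟨ρ, ?_, ?_, ?_⟩
  · intro x hx y hy hc
    rw [hρ x hx, hρ y hy]
    by_contra hlt
    have h := hm (show σ.symm (e ⟨y, hy⟩) ≤ σ.symm (e ⟨x, hx⟩) from not_lt.1 hlt)
    rw [hκ, hκ] at h
    omega
  · intro x hx
    rw [hρ x hx]
    exact Fin.isLt _
  · intro i hi
    refine ⟨e.symm (σ ⟨i, hi⟩), (e.symm (σ ⟨i, hi⟩)).2, ?_, ?_⟩
    · rw [hρ _ (e.symm (σ ⟨i, hi⟩)).2]
      simp
    · intro y hy h
      rw [hρ y hy] at h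
      have : σ.symm (e ⟨y, hy⟩) = ⟨i, hi⟩ := Fin.ext h
      rw [← this]
      simp

end Helpers

/-- **Pareto Path Existence.** If `πA` and `πB` are neighboring deterministic Pareto front
policies differing in exactly `k` states, then there is a sequence of `k+1` deterministic
Pareto front policies from `πA` to `πB` in which consecutive policies differ in exactly
one state. -/
theorem pareto_path_existence {X A : Type} [Fintype X] [Fintype A] {d : ℕ}
    (M : MOMDP X A d) (πA πB : X → A) (k : ℕ)
    (hA : IsPF M (detPolicy πA)) (hB : IsPF M (detPolicy πB))
    (hdiff : (Finset.univ.filter fun x => πA x ≠ πB x).card = k)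
    (hneighbor : ∃ w : Fin d → ℝ, (∀ i, 0 ≤ w i) ∧
      {J : Fin d → ℝ |
          (∃ π : X → A → ℝ, IsPolicy π ∧ J = fun i => Jret M π i) ∧
          ∀ π' : X → A → ℝ, IsPolicy π' →
            ∑ i, w i * Jret M π' i ≤ ∑ i, w i * J i } =
        segment ℝ (fun i => Jret M (detPolicy πA) i) (fun i => Jret M (detPolicy πB) i)) :
    ∃ seq : Fin (k + 1) → X → A,
      seq 0 = πA ∧ seq (Fin.last k) = πB ∧
      (∀ i, IsPF M (detPolicy (seq i))) ∧
      ∀ i : Fin k,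
        (Finset.univ.filter fun x => seq i.castSucc x ≠ seq i.succ x).card = 1 := by
  obtain ⟨w, hwnn, hset⟩ := hneighbor
  have hX : Nonempty X := by
    by_contra h
    rw [not_nonempty_iff] at h
    have := M.init_sum_one
    simp at this
  have : Nonempty A := hX.map πA
  obtain ⟨V, f0, hV, hf0⟩ := exists_value M (fun x a => ∑ i, w i * M.r x a i)
  set g : X → A → ℝ := fun x a => V x -
      (∑ i, w i * M.r x a i + M.disc * ∑ y, M.P x a y * V y) with hgdef
  have hg : ∀ x a, 0 ≤ g x a := fun x a => sub_nonneg.2 (hV x a)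
  have hgap : ∀ π, IsPolicy π →
      ∑ i, w i * Jret M π i + totE M π g = ∑ x, M.init x * V x := fun π hπ => wJ_gap M hπ w V
  have hEnn : ∀ π, IsPolicy π → 0 ≤ totE M π g := fun π hπ =>
    tsum_nonneg (stepE_nonneg M hπ hg)
  have hf0opt : totE M (detPolicy f0) g = 0 :=
    gap_zero_of_closed M f0 Set.univ (fun _ _ => trivial) (fun _ _ _ _ => trivial)
      (fun x _ => sub_eq_zero.2 (hf0 x).symm)
  -- optimal endpoints have zero gap
  have hend : ∀ f : X → A, (fun i => Jret M (detPolicy f) i) ∈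
      segment ℝ (fun i => Jret M (detPolicy πA) i) (fun i => Jret M (detPolicy πB) i) →
      totE M (detPolicy f) g = 0 := by
    intro f hf
    rw [← hset] at hf
    have h1 := hf.2 _ (isPolicy_det f0)
    have h2 := hgap _ (isPolicy_det f0)
    have h3 := hgap _ (isPolicy_det f)
    have h4 := hEnn _ (isPolicy_det f)
    linarith
  have hAopt := hend πA (left_mem_segment ℝ _ _)
  have hBopt := hend πB (right_mem_segment ℝ _ _)
  -- zero gap implies Pareto optimality
  have hmem : ∀ π, IsPolicy π → ∑ x, M.init x * V x ≤ ∑ i, w i * Jret M π i →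
      (fun i => Jret M π i) ∈
      segment ℝ (fun i => Jret M (detPolicy πA) i) (fun i => Jret M (detPolicy πB) i) := by
    intro π hπ h
    rw [← hset]
    refine ⟨⟨π, hπ, rfl⟩, fun π' hπ' => ?_⟩
    have h3 := hgap _ hπ'
    have h4 := hEnn _ hπ'
    show _ ≤ ∑ i, w i * Jret M π i
    linarith
  have hPF : ∀ f : X → A, totE M (detPolicy f) g = 0 → IsPF M (detPolicy f) := by
    rintro f hf ⟨π', hπ', hle, j, hj⟩
    have h1 := hgap _ (isPolicy_det f)
    have hd0 : ∑ x, M.init x * V x ≤ ∑ i, w i * Jret M (detPolicy f) i := by linarith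
    have hm1 := hmem _ (isPolicy_det f) hd0
    have hw := hwnn
    have hd1 : ∑ i, w i * Jret M (detPolicy f) i ≤ ∑ i, w i * Jret M π' i :=
      Finset.sum_le_sum fun i _ => mul_le_mul_of_nonneg_left (hle i) (hw i)
    have hm2 := hmem π' hπ' (hd0.trans hd1)
    rw [segment_eq_image] at hm1 hm2
    obtain ⟨s, -, hs⟩ := hm1
    obtain ⟨t, -, ht⟩ := hm2
    have hdiffJ : ∀ i, Jret M π' i - Jret M (detPolicy f) i =
        (t - s) * (Jret M (detPolicy πB) i - Jret M (detPolicy πA) i) := by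
      intro i
      have e1 := congrFun hs i
      have e2 := congrFun ht i
      simp only [Pi.add_apply, Pi.smul_apply, smul_eq_mul] at e1 e2
      rw [← e1, ← e2]
      ring
    rcases lt_trichotomy s t with h | h | h
    · refine hA ⟨detPolicy πB, isPolicy_det πB, fun i => ?_, j, ?_⟩
      · have e := hdiffJ i
        have := hle i
        by_contra hc
        nlinarith
      · have e := hdiffJ j
        by_contra hc
        nlinarith
    · have e := hdiffJ j
      rw [h] at e
      linarith
    · refine hB ⟨detPolicy πA, isPolicy_det πA, fun i => ?_, j, ?_⟩
      · have e := hdiffJ i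
        have := hle i
        by_contra hc
        nlinarith
      · have e := hdiffJ j
        by_contra hc
        nlinarith
  -- the ordering of states
  let c : X → ℕ := fun x => if x ∈ reach M πA then (if x ∈ reach M πB then 1 else 2) else 0
  obtain ⟨ρ, hρc, hρk, hρs⟩ := exists_rank (Finset.univ.filter fun x => πA x ≠ πB x) k hdiff c
  have hmemD : ∀ x, x ∈ (Finset.univ.filter fun x => πA x ≠ πB x) ↔ πA x ≠ πB x := by simp
  simp only [hmemD] at hρc hρk hρs
  refine ⟨fun j x => if ρ x < j then πB x else πA x, ?_, ?_, ?_, ?_⟩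
  · funext x
    simp
  · funext x
    by_cases h : πA x = πB x
    · simp [h]
    · simp [hρk x h]
  · intro j
    apply hPF
    set σ : X → A := fun x => if ρ x < j then πB x else πA x with hσ
    have hgA : ∀ x ∈ reach M πA, g x (πA x) = 0 := fun x hx => gap_zero_of_reach M πA hg hAopt hx
    have hgB : ∀ x ∈ reach M πB, g x (πB x) = 0 := fun x hx => gap_zero_of_reach M πB hg hBopt hx
    by_cases h1 : ∀ x ∈ reach M πA, σ x = πA x
    · refine gap_zero_of_closed M σ (reach M πA) (fun x hx => init_reach M πA hx) ?_ ?_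
      · intro x y hx h
        rw [h1 x hx] at h
        exact step_reach M πA hx h
      · intro x hx
        rw [h1 x hx]
        exact hgA x hx
    by_cases h2 : ∀ x ∈ reach M πB, σ x = πB x
    · refine gap_zero_of_closed M σ (reach M πB) (fun x hx => init_reach M πB hx) ?_ ?_
      · intro x y hx h
        rw [h2 x hx] at h
        exact step_reach M πB hx h
      · intro x hx
        rw [h2 x hx]
        exact hgB x hx
    push Not at h1 h2
    obtain ⟨x1, hx1, hx1'⟩ := h1
    obtain ⟨x2, hx2, hx2'⟩ := h2
    have a1 : ρ x1 < j ∧ πA x1 ≠ πB x1 := by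
      by_cases h : ρ x1 < j
      · refine ⟨h, fun h' => hx1' ?_⟩
        simp [hσ, h']
      · exact absurd (by simp [hσ, h]) hx1'
    have a2 : ¬ ρ x2 < j ∧ πA x2 ≠ πB x2 := by
      by_cases h : ρ x2 < j
      · exact absurd (by simp [hσ, h]) hx2'
      · refine ⟨h, fun h' => hx2' ?_⟩
        simp [hσ, h']
    have hc1 : 1 ≤ c x1 := by
      simp only [c, hx1, if_true]
      split_ifs <;> omega
    have hc2 : c x2 ≤ 1 := by
      simp only [c, hx2, if_true]
      split_ifs <;> omega
    have hnA : ∀ x, x ∉ reach M πA → σ x = πB x := by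
      intro x hx
      by_cases h : πA x = πB x
      · simp [hσ, h]
      · have hcx : c x = 0 := by simp [c, hx]
        have := hρc x h x1 a1.2 (by omega)
        simp only [hσ]
        rw [if_pos (this.trans a1.1)]
    have hnB : ∀ x, x ∈ reach M πA → x ∉ reach M πB → σ x = πA x := by
      intro x hxA hx
      by_cases h : πA x = πB x
      · simp [hσ, h]
      · have hcx : c x = 2 := by simp [c, hx, hxA]
        have := hρc x2 a2.2 x h (by omega)
        simp only [hσ]
        rw [if_neg (by have := a2.1; omega)]
    have hor : ∀ x, x ∈ reach M πA ∪ reach M πB →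
        (x ∈ reach M πA ∧ σ x = πA x) ∨ (x ∈ reach M πB ∧ σ x = πB x) := by
      intro x hx
      by_cases hxA : x ∈ reach M πA
      · by_cases hxB : x ∈ reach M πB
        · by_cases h : ρ x < j
          · exact Or.inr ⟨hxB, by simp [hσ, h]⟩
          · exact Or.inl ⟨hxA, by simp [hσ, h]⟩
        · exact Or.inl ⟨hxA, hnB x hxA hxB⟩
      · exact Or.inr ⟨hx.resolve_left hxA, hnA x hxA⟩
    refine gap_zero_of_closed M σ (reach M πA ∪ reach M πB)
      (fun x hx => Or.inl (init_reach M πA hx)) ?_ ?_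
    · intro x y hx h
      rcases hor x hx with ⟨h1, h2⟩ | ⟨h1, h2⟩
      · rw [h2] at h
        exact Or.inl (step_reach M πA h1 h)
      · rw [h2] at h
        exact Or.inr (step_reach M πB h1 h)
    · intro x hx
      rcases hor x hx with ⟨h1, h2⟩ | ⟨h1, h2⟩
      · rw [h2]
        exact hgA x h1
      · rw [h2]
        exact hgB x h1
  · intro i
    obtain ⟨x, hx, hxi, huniq⟩ := hρs i i.isLt
    rw [Finset.card_eq_one]
    refine ⟨x, ?_⟩
    ext y
    simp only [Finset.mem_filter, Finset.mem_univ, true_and, Finset.mem_singleton,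
      Fin.val_castSucc, Fin.val_succ]
    constructor
    · intro h
      by_cases hy : πA y = πB y
      · simp [hy] at h
      · apply huniq y hy
        by_contra hne
        apply h
        by_cases h' : ρ y < i
        · rw [if_pos h', if_pos (by omega)]
        · rw [if_neg h', if_neg (by omega)]
    · rintro rfl
      rw [if_neg (by omega), if_pos (by omega)]
      exact hx
end

section
/- There exists a MOMDP with d = 2 objectives, two deterministic Pareto front policies π_1 and π_2, and a policy π* such that the state-wise average policy π_out defined by π_out(a|x) = (π_1(a|x) + π_2(a|x))/2 for all states x and actions a (which is the infinite-data limit of behavioral cloning run on the pooled dataset of the two experts sampled in equal proportion) satisfies J_i(π*) ≥ J_i(π_out) + 1/(3(1−γ)) for every objective i ∈ {1, 2}. -/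
open scoped BigOperators
open Classical

/-- The failure property: two deterministic Pareto front experts whose state-wise
average policy (the infinite data limit of behavioral cloning on the pooled dataset)
is dominated by a margin of `1/(3(1-γ))` in every objective by some policy `π*`. -/
def AvgBCFailure (X A : Type) [iX : Fintype X] [iA : Fintype A] (M : MOMDP X A 2) : Prop :=
  ∃ (π1 π2 : X → A) (πstar : X → A → ℝ),
    IsPF M (detPolicy π1) ∧ IsPF M (detPolicy π2) ∧ IsPolicy πstar ∧
    ∀ i : Fin 2,
      Jret M (fun x a => (detPolicy π1 x a + detPolicy π2 x a) / 2) i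
          + 1 / (3 * (1 - M.disc)) ≤ Jret M πstar i

/-- Rewards of the three actions of the one-state example. -/
noncomputable def exR (a : Fin 3) (i : Fin 2) : ℝ :=
  if a = 2 then 5 / 6 else if a.val = i.val then 1 else 0

/-- The one-state example: two extreme actions and one good compromise. -/
noncomputable def exM (γ : ℝ) (h0 : 0 ≤ γ) (h1 : γ < 1) : MOMDP Unit (Fin 3) 2 where
  P := fun _ _ _ => 1
  P_nonneg := fun _ _ _ => zero_le_one
  P_sum_one := fun _ _ => by simp
  disc := γ
  disc_nonneg := h0
  disc_lt_one := h1
  init := fun _ => 1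
  init_nonneg := fun _ => zero_le_one
  init_sum_one := by simp
  r := fun _ a i => exR a i
  r_nonneg := fun _ a i => by unfold exR; split_ifs <;> norm_num
  r_le_one := fun _ a i => by unfold exR; split_ifs <;> norm_num

theorem exM_stateDist (γ : ℝ) (h0 : 0 ≤ γ) (h1 : γ < 1) (π : Unit → Fin 3 → ℝ)
    (hπ : IsPolicy π) (t : ℕ) (x : Unit) : stateDist (exM γ h0 h1) π t x = 1 := by
  induction t generalizing x with
  | zero => rfl
  | succ t ih =>
    have h := hπ.2 ()
    simp only [stateDist, ih]
    simpa [exM] using h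

theorem exM_J (γ : ℝ) (h0 : 0 ≤ γ) (h1 : γ < 1) (π : Unit → Fin 3 → ℝ)
    (hπ : IsPolicy π) (i : Fin 2) :
    Jret (exM γ h0 h1) π i = (1 - γ)⁻¹ * ∑ a, π () a * exR a i := by
  unfold Jret
  simp only [exM_stateDist γ h0 h1 π hπ]
  rw [tsum_mul_right]
  simp [exM, tsum_geometric_of_lt_one h0 h1]

theorem det_isPolicy (f : Unit → Fin 3) : IsPolicy (detPolicy f) := by
  refine ⟨fun x a => ?_, fun x => ?_⟩
  · unfold detPolicy; split_ifs <;> norm_num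
  · unfold detPolicy
    rw [Finset.sum_eq_single (f x)] <;> simp +contextual

theorem avg_isPolicy (f g : Unit → Fin 3) :
    IsPolicy (fun x a => (detPolicy f x a + detPolicy g x a) / 2) := by
  have hf := det_isPolicy f
  have hg := det_isPolicy g
  refine ⟨fun x a => ?_, fun x => ?_⟩
  · have := hf.1 x a
    have := hg.1 x a
    positivity
  · rw [← Finset.sum_div, Finset.sum_add_distrib, hf.2, hg.2]; norm_num

theorem exM_PF (γ : ℝ) (h0 : 0 ≤ γ) (h1 : γ < 1) (f : Unit → Fin 3)
    (hf : f () = 0 ∨ f () = 1) : IsPF (exM γ h0 h1) (detPolicy f) := by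
  rintro ⟨π, hπ, hle, j, hj⟩
  have hpos : 0 < (1 - γ)⁻¹ := inv_pos.2 (by linarith)
  simp only [exM_J γ h0 h1 _ hπ, exM_J γ h0 h1 _ (det_isPolicy f)] at hle hj
  have hle0 := le_of_mul_le_mul_left (hle 0) hpos
  have hle1 := le_of_mul_le_mul_left (hle 1) hpos
  have hj' := lt_of_mul_lt_mul_left hj hpos.le
  have hs := hπ.2 ()
  have n0 := hπ.1 () 0
  have n1 := hπ.1 () 1
  have n2 := hπ.1 () 2
  rw [Fin.sum_univ_three] at hs
  rcases hf with hf | hf <;> fin_cases j <;>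
    simp [Fin.sum_univ_three, exR, detPolicy, hf] at hle0 hle1 hj' <;> linarith

/-- **Failure of single-output behavioral cloning.** For every discount factor there
exists a MOMDP with two objectives, two deterministic Pareto front experts, and a policy
`π*` that dominates the state-wise average of the two experts by `1/(3(1-γ))` in every
objective. -/
theorem single_output_bc_failure (γ : ℝ) (h0 : 0 ≤ γ) (h1 : γ < 1) :
    ∃ (X A : Type) (iX : Fintype X) (iA : Fintype A) (M : @MOMDP X A iX iA 2),
      M.disc = γ ∧ @AvgBCFailure X A iX iA M := by
  refine ⟨Unit, Fin 3, inferInstance, inferInstance, exM γ h0 h1, rfl, ?_⟩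
  refine ⟨fun _ => 0, fun _ => 1, detPolicy (fun _ => 2), exM_PF γ h0 h1 _ (Or.inl rfl),
    exM_PF γ h0 h1 _ (Or.inr rfl), det_isPolicy _, fun i => ?_⟩
  rw [exM_J γ h0 h1 _ (avg_isPolicy _ _), exM_J γ h0 h1 _ (det_isPolicy _)]
  have hd : (exM γ h0 h1).disc = γ := rfl
  have hne : 1 - γ ≠ 0 := by linarith
  rw [hd]
  apply le_of_eq
  fin_cases i <;> simp [Fin.sum_univ_three, exR, detPolicy] <;> field_simp <;> norm_num
end
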